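/- For every α ∈ ℂ, the spectrum of L + αJ̃ consists of all nonzero eigenvalues of L (with multiplicities) together with α with multiplicity d; in particular L + αJ̃ is nonsingular for every α ≠ 0. -/

import Mathlib

open Matrix Finset Polynomial

/-- `A` is (the arc set of) an in-forest of the weighted digraph with arc-weight
matrix `W`: all arcs are loopless arcs of positive weight, every vertex has
outdegree at most one, and there are no directed cycles. -/
def IsInForest {n : ℕ} (W : Matrix (Fin n) (Fin n) ℝ)
    (A : Finset (Fin n × Fin n)) : Prop :=
  (∀ e ∈ A, e.1 ≠ e.2 ∧ 0 < W e.1 e.2) ∧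
  (∀ i : Fin n, (A.filter (fun e => e.1 = i)).card ≤ 1) ∧
  (∀ i : Fin n, ¬ Relation.TransGen (fun a b => (a, b) ∈ A) i i)

/-- The weight of a forest: the product of its arc weights. -/
def forestWeight {n : ℕ} (W : Matrix (Fin n) (Fin n) ℝ)
    (A : Finset (Fin n × Fin n)) : ℝ :=
  ∏ e ∈ A, W e.1 e.2

/-- `i` belongs to the tree of the forest `A` converging to (rooted at) `j`. -/
def InTreeRootedAt {n : ℕ} (A : Finset (Fin n × Fin n)) (i j : Fin n) : Prop :=
  Relation.ReflTransGen (fun a b => (a, b) ∈ A) i j ∧ ∀ e ∈ A, e.1 ≠ j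

open scoped Classical in
/-- `σ_k`: the total weight of in-forests with `k` arcs. -/
noncomputable def sigmaW {n : ℕ} (W : Matrix (Fin n) (Fin n) ℝ) (k : ℕ) : ℝ :=
  ∑ A ∈ Finset.univ.powerset.filter
      (fun A => IsInForest W A ∧ A.card = k), forestWeight W A

open scoped Classical in
/-- `Q_k`: the matrix of in-forests with `k` arcs; its `(i,j)` entry is the total
weight of in-forests with `k` arcs in which `i` belongs to a tree rooted at `j`. -/
noncomputable def forestMatrix {n : ℕ} (W : Matrix (Fin n) (Fin n) ℝ) (k : ℕ) :
    Matrix (Fin n) (Fin n) ℝ :=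
  Matrix.of fun i j =>
    ∑ A ∈ Finset.univ.powerset.filter
        (fun A => IsInForest W A ∧ A.card = k ∧ InTreeRootedAt A i j),
      forestWeight W A

open scoped Classical in
/-- `σ`: the total weight of all in-forests. -/
noncomputable def sigmaTot {n : ℕ} (W : Matrix (Fin n) (Fin n) ℝ) : ℝ :=
  ∑ A ∈ Finset.univ.powerset.filter (fun A => IsInForest W A), forestWeight W A

open scoped Classical in
/-- `Q`: the matrix of all in-forests. -/
noncomputable def forestMatrixTot {n : ℕ} (W : Matrix (Fin n) (Fin n) ℝ) :
    Matrix (Fin n) (Fin n) ℝ :=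
  Matrix.of fun i j =>
    ∑ A ∈ Finset.univ.powerset.filter
        (fun A => IsInForest W A ∧ InTreeRootedAt A i j), forestWeight W A

open scoped Classical in
/-- The number of arcs in a maximum in-forest (equal to `n - d` where `d` is the
in-forest dimension). -/
noncomputable def maxForestCard {n : ℕ} (W : Matrix (Fin n) (Fin n) ℝ) : ℕ :=
  (Finset.univ.powerset.filter (fun A => IsInForest W A)).sup Finset.card

/-- The in-forest dimension `d` of the digraph. -/
noncomputable def forestDim {n : ℕ} (W : Matrix (Fin n) (Fin n) ℝ) : ℕ :=
  n - maxForestCard W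

/-- The (row) Laplacian matrix of the weighted digraph with arc-weight matrix `W`. -/
def lap {n : ℕ} (W : Matrix (Fin n) (Fin n) ℝ) : Matrix (Fin n) (Fin n) ℝ :=
  Matrix.diagonal (fun i => ∑ j, W i j) - W

/-- `J̃`: the normalized matrix of maximum in-forests. -/
noncomputable def Jtilde {n : ℕ} (W : Matrix (Fin n) (Fin n) ℝ) :
    Matrix (Fin n) (Fin n) ℝ :=
  (sigmaW W (maxForestCard W))⁻¹ • forestMatrix W (maxForestCard W)

section Reachability

variable {n : ℕ} {A : Finset (Fin n × Fin n)} {i j l m : Fin n}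

lemma inTreeRootedAt_of_root (hi : ∀ e ∈ A, e.1 ≠ i) : InTreeRootedAt A i j ↔ i = j := by
  constructor
  · rintro ⟨h, -⟩
    rcases h.cases_head with h | ⟨c, hc, -⟩
    · exact h
    · exact absurd rfl (hi _ hc)
  · rintro rfl
    exact ⟨.refl, hi⟩

lemma inTreeRootedAt_self : InTreeRootedAt A i i ↔ ∀ e ∈ A, e.1 ≠ i :=
  ⟨fun h => h.2, fun h => ⟨.refl, h⟩⟩

lemma inTreeRootedAt_congr_of_mem (hA : ∀ i : Fin n, (A.filter (fun e => e.1 = i)).card ≤ 1)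
    (h : (i, m) ∈ A) : InTreeRootedAt A i j ↔ InTreeRootedAt A m j := by
  constructor
  · rintro ⟨hij, hj⟩
    rcases hij.cases_head with rfl | ⟨c, hc, hcj⟩
    · exact absurd rfl (hj _ h)
    · have := Finset.card_le_one.1 (hA i) (i, c) (by simp [hc]) (i, m) (by simp [h])
      obtain rfl : c = m := by simpa using this
      exact ⟨hcj, hj⟩
  · rintro ⟨hmj, hj⟩
    exact ⟨.head h hmj, hj⟩

lemma inTreeRootedAt_congr_of_reach (hA : ∀ i : Fin n, (A.filter (fun e => e.1 = i)).card ≤ 1)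
    (h : Relation.ReflTransGen (fun a b => (a, b) ∈ A) l i) :
    InTreeRootedAt A l j ↔ InTreeRootedAt A i j := by
  induction h using Relation.ReflTransGen.head_induction_on with
  | refl => rfl
  | head h _ ih => exact (inTreeRootedAt_congr_of_mem hA h).trans ih

lemma reach_insert (hl : ¬ Relation.ReflTransGen (fun a b => (a, b) ∈ A) l i)
    (h : Relation.ReflTransGen (fun a b => (a, b) ∈ insert (i, m) A) l j) :
    Relation.ReflTransGen (fun a b => (a, b) ∈ A) l j := by
  induction h with
  | refl => rfl
  | tail _ hbc ih =>
    rcases Finset.mem_insert.1 hbc with h | h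
    · obtain ⟨rfl, rfl⟩ := Prod.mk.inj h
      exact absurd ih hl
    · exact ih.tail h

lemma reach_mono {B : Finset (Fin n × Fin n)} (hAB : A ⊆ B)
    (h : Relation.ReflTransGen (fun a b => (a, b) ∈ A) l j) :
    Relation.ReflTransGen (fun a b => (a, b) ∈ B) l j :=
  Relation.ReflTransGen.mono (fun _ _ hab => hAB hab) _ _ h

lemma inTreeRootedAt_insert (hl : ¬ Relation.ReflTransGen (fun a b => (a, b) ∈ A) l i) :
    InTreeRootedAt (insert (i, m) A) l j ↔ InTreeRootedAt A l j := by
  constructor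
  · rintro ⟨h, hj⟩
    exact ⟨reach_insert hl h, fun e he => hj e (Finset.mem_insert_of_mem he)⟩
  · rintro ⟨h, hj⟩
    refine ⟨reach_mono (Finset.subset_insert _ _) h, fun e he => ?_⟩
    rcases Finset.mem_insert.1 he with rfl | he
    · rintro rfl
      exact hl h
    · exact hj e he

lemma transGen_insert (hm : ¬ Relation.ReflTransGen (fun a b => (a, b) ∈ A) m i)
    (h : Relation.TransGen (fun a b => (a, b) ∈ insert (i, m) A) l j) :
    Relation.TransGen (fun a b => (a, b) ∈ A) l j ∨
      Relation.ReflTransGen (fun a b => (a, b) ∈ A) l i ∧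
        Relation.ReflTransGen (fun a b => (a, b) ∈ A) m j := by
  induction h with
  | single h =>
    rcases Finset.mem_insert.1 h with h | h
    · obtain ⟨rfl, rfl⟩ := Prod.mk.inj h
      exact .inr ⟨.refl, .refl⟩
    · exact .inl (.single h)
  | tail _ hbc ih =>
    rcases Finset.mem_insert.1 hbc with h | h
    · obtain ⟨rfl, rfl⟩ := Prod.mk.inj h
      rcases ih with ih | ih
      · exact .inr ⟨ih.to_reflTransGen, .refl⟩
      · exact absurd ih.2 hm
    · rcases ih with ih | ih
      · exact .inl (ih.tail h)
      · exact .inr ⟨ih.1, ih.2.tail h⟩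

end Reachability

section Forests

variable {n : ℕ} {W : Matrix (Fin n) (Fin n) ℝ} {A B : Finset (Fin n × Fin n)} {i j l m : Fin n}

lemma isInForest_empty : IsInForest W ∅ := by
  refine ⟨by simp, by simp, fun i h => ?_⟩
  obtain ⟨_, h, -⟩ := Relation.TransGen.head'_iff.1 h
  simp at h

lemma IsInForest.mono (hB : IsInForest W B) (h : A ⊆ B) : IsInForest W A :=
  ⟨fun e he => hB.1 e (h he),
    fun i => (Finset.card_le_card (Finset.filter_subset_filter _ h)).trans (hB.2.1 i),
    fun i hi => hB.2.2 i (Relation.TransGen.mono (fun _ _ hab => h hab) _ _ hi)⟩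

lemma IsInForest.insert (hA : IsInForest W A) (hi : ∀ e ∈ A, e.1 ≠ i)
    (hm : ¬ Relation.ReflTransGen (fun a b => (a, b) ∈ A) m i) (hw : 0 < W i m) :
    IsInForest W (insert (i, m) A) := by
  refine ⟨fun e he => ?_, fun a => ?_, fun a ha => ?_⟩
  · rcases Finset.mem_insert.1 he with rfl | he
    · exact ⟨fun h : i = m => hm (h ▸ .refl), hw⟩
    · exact hA.1 e he
  · rw [Finset.filter_insert]
    split_ifs with h
    · obtain rfl : i = a := h
      rw [Finset.filter_false_of_mem hi]
      simp
    · exact hA.2.1 a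
  · rcases transGen_insert hm ha with h | h
    · exact hA.2.2 a h
    · exact hm (h.2.trans h.1)

lemma IsInForest.root_erase (hA : IsInForest W A) (h : (i, m) ∈ A) :
    ∀ e ∈ A.erase (i, m), e.1 ≠ i := by
  rintro e he rfl
  obtain ⟨hne, he⟩ := Finset.mem_erase.1 he
  exact hne (Finset.card_le_one.1 (hA.2.1 e.1) e (by simp [he]) (e.1, m) (by simp [h]))

lemma IsInForest.not_reach_erase (hA : IsInForest W A) (h : (i, m) ∈ A) :
    ¬ Relation.ReflTransGen (fun a b => (a, b) ∈ A.erase (i, m)) m i := fun hm =>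
  hA.2.2 i (Relation.TransGen.head' h (reach_mono (Finset.erase_subset _ _) hm))

lemma IsInForest.injOn_fst (hA : IsInForest W A) :
    Set.InjOn Prod.fst (A : Set (Fin n × Fin n)) := fun e he f hf h =>
  Finset.card_le_one.1 (hA.2.1 e.1) e (by simpa using he) f
    (by simpa [h] using hf)

lemma IsInForest.card_image_fst (hA : IsInForest W A) : (A.image Prod.fst).card = A.card :=
  Finset.card_image_of_injOn hA.injOn_fst

lemma IsInForest.card_le (hA : IsInForest W A) : A.card ≤ n := by
  rw [← hA.card_image_fst]
  simpa using Finset.card_le_univ (A.image Prod.fst)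

lemma IsInForest.forestWeight_pos (hA : IsInForest W A) : 0 < forestWeight W A :=
  Finset.prod_pos fun e he => (hA.1 e he).2

lemma forestWeight_insert (hi : ∀ e ∈ A, e.1 ≠ i) :
    forestWeight W (insert (i, m) A) = W i m * forestWeight W A :=
  Finset.prod_insert fun h => hi _ h rfl

lemma card_insert_of_root (hi : ∀ e ∈ A, e.1 ≠ i) : (insert (i, m) A).card = A.card + 1 :=
  Finset.card_insert_of_notMem fun h => hi _ h rfl

variable (W)

open scoped Classical in
/-- The finite set of all in-forests of the weighted digraph. -/
noncomputable def inForests : Finset (Finset (Fin n × Fin n)) :=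
  Finset.univ.filter fun A => IsInForest W A

open scoped Classical in
/-- The indicator of `i` belonging to the tree of `A` rooted at `j`. -/
noncomputable def treeInd (A : Finset (Fin n × Fin n)) (i j : Fin n) : ℝ :=
  if InTreeRootedAt A i j then 1 else 0

variable {W}

lemma mem_inForests : A ∈ inForests W ↔ IsInForest W A := by
  simp [inForests]

lemma treeInd_congr (h : InTreeRootedAt A i j ↔ InTreeRootedAt B l j) :
    treeInd A i j = treeInd B l j := by
  classical exact if_congr h rfl rfl

lemma treeInd_of_root (hi : ∀ e ∈ A, e.1 ≠ i) :
    treeInd A i j = (1 : Matrix (Fin n) (Fin n) ℝ) i j := by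
  simp [treeInd, inTreeRootedAt_of_root hi, Matrix.one_apply]

lemma sigmaW_eq (k : ℕ) :
    sigmaW W k = ∑ A ∈ inForests W, forestWeight W A * if A.card = k then 1 else 0 := by
  simp [sigmaW, inForests, Finset.sum_filter, ite_and]

lemma forestMatrix_apply (k : ℕ) :
    forestMatrix W k i j =
      ∑ A ∈ inForests W, forestWeight W A * if A.card = k then treeInd A i j else 0 := by
  simp [forestMatrix, inForests, treeInd, Finset.sum_filter, ite_and]

open scoped Classical in
/-- Every in-forest is either one in which `i` is a root, or arises from such a forest by adding
an arc from `i` to a vertex outside the tree rooted at `i`. -/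
lemma sum_inForests (hW : ∀ i j, 0 ≤ W i j) (i : Fin n) (Ψ : Finset (Fin n × Fin n) → ℝ) :
    ∑ A ∈ inForests W, forestWeight W A * Ψ A =
      ∑ A ∈ (inForests W).filter (fun A => ∀ e ∈ A, e.1 ≠ i), forestWeight W A *
        (Ψ A + ∑ m, if Relation.ReflTransGen (fun a b => (a, b) ∈ A) m i then 0
          else W i m * Ψ (insert (i, m) A)) := by
  rw [← Finset.sum_filter_add_sum_filter_not _ (fun A => ∀ e ∈ A, e.1 ≠ i)]
  simp only [mul_add, Finset.sum_add_distrib]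
  congr 1
  simp only [Finset.mul_sum]
  rw [← Finset.sum_product']
  symm
  rw [← Finset.sum_filter_of_ne (p := fun x => 0 < W i x.2 ∧
    ¬ Relation.ReflTransGen (fun a b => (a, b) ∈ x.1) x.2 i)]
  · refine Finset.sum_bij (fun x _ => insert (i, x.2) x.1) ?_ ?_ ?_ ?_
    · rintro ⟨G, m⟩ h
      simp only [Finset.mem_filter, Finset.mem_product, mem_inForests] at h ⊢
      obtain ⟨⟨⟨hG, hi⟩, -⟩, hw, hm⟩ := h
      exact ⟨hG.insert hi hm hw, fun h => h _ (Finset.mem_insert_self _ _) rfl⟩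
    · rintro ⟨G, m⟩ h ⟨G', m'⟩ h' heq
      simp only [Finset.mem_filter, Finset.mem_product] at h h' heq
      have hG := h.1.1.2
      have hG' := h'.1.1.2
      have hmm : (i, m) ∈ insert (i, m') G' := heq ▸ Finset.mem_insert_self _ _
      obtain rfl : m = m' := by
        rcases Finset.mem_insert.1 hmm with h | h
        · simpa using h
        · exact absurd rfl (hG' _ h)
      have := congrArg (fun B => B.erase (i, m)) heq
      rw [Finset.erase_insert fun h => hG _ h rfl, Finset.erase_insert fun h => hG' _ h rfl] at this
      rw [this]
    · intro F hF
      simp only [Finset.mem_filter, mem_inForests, not_forall, not_not] at hF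
      obtain ⟨hF, ⟨a, m⟩, he, rfl⟩ := hF
      refine ⟨(F.erase (a, m), m), ?_, Finset.insert_erase he⟩
      simp only [Finset.mem_filter, Finset.mem_product, mem_inForests, Finset.mem_univ, and_true]
      exact ⟨⟨hF.mono (Finset.erase_subset _ _), hF.root_erase he⟩, (hF.1 _ he).2,
        hF.not_reach_erase he⟩
    · rintro ⟨G, m⟩ h
      simp only [Finset.mem_filter, Finset.mem_product] at h
      rw [if_neg h.2.2, forestWeight_insert h.1.1.2]
      ring
  · rintro ⟨G, m⟩ - h
    simp only at h ⊢
    by_contra hc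
    apply h
    split_ifs with h'
    · simp
    · have : W i m = 0 := le_antisymm (not_lt.1 fun h => hc ⟨h, h'⟩) (hW i m)
      simp [this]

lemma lap_mul_apply (M : Matrix (Fin n) (Fin n) ℝ) :
    (lap W * M) i j = ∑ l, W i l * (M i j - M l j) := by
  rw [lap, Matrix.sub_mul, Matrix.sub_apply, Matrix.diagonal_mul, Matrix.mul_apply,
    Finset.sum_mul, ← Finset.sum_sub_distrib]
  simp only [mul_sub]

lemma lap_mul_forestMatrix_apply (k : ℕ) :
    (lap W * forestMatrix W k) i j = ∑ A ∈ inForests W, forestWeight W A *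
      if A.card = k then ∑ l, W i l * (treeInd A i j - treeInd A l j) else 0 := by
  simp only [lap_mul_apply, forestMatrix_apply, ← Finset.sum_sub_distrib, Finset.mul_sum]
  rw [Finset.sum_comm]
  refine Finset.sum_congr rfl fun A _ => ?_
  split_ifs
  · rw [Finset.mul_sum]
    exact Finset.sum_congr rfl fun l _ => by ring
  · simp

/-- Adding one arc to forests: the recurrence between consecutive forest matrices. -/
theorem forestMatrix_succ (hW : ∀ i j, 0 ≤ W i j) (k : ℕ) :
    forestMatrix W (k + 1) =
      sigmaW W (k + 1) • (1 : Matrix (Fin n) (Fin n) ℝ) - lap W * forestMatrix W k := by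
  classical
  ext i j
  rw [Matrix.sub_apply, Matrix.smul_apply, smul_eq_mul, lap_mul_forestMatrix_apply, sigmaW_eq,
    forestMatrix_apply, Finset.sum_mul, ← Finset.sum_sub_distrib, ← sub_eq_zero,
    ← Finset.sum_sub_distrib]
  let δ : ℝ := (1 : Matrix (Fin n) (Fin n) ℝ) i j
  let Ψ : Finset (Fin n × Fin n) → ℝ := fun A =>
    (if A.card = k + 1 then treeInd A i j - δ else 0) +
      if A.card = k then ∑ l, W i l * (treeInd A i j - treeInd A l j) else 0
  trans ∑ A ∈ inForests W, forestWeight W A * Ψ A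
  · refine Finset.sum_congr rfl fun A _ => ?_
    simp only [Ψ, δ]
    split_ifs <;> ring
  rw [sum_inForests hW i]
  refine Finset.sum_eq_zero fun G hG => ?_
  obtain ⟨hGf, hi⟩ := Finset.mem_filter.1 hG
  rw [mem_inForests] at hGf
  let χ : Fin n → ℝ := fun m => if Relation.ReflTransGen (fun a b => (a, b) ∈ G) m i then 0 else 1
  have hδ : treeInd G i j = δ := treeInd_of_root hi
  have hG_row : ∀ l, treeInd G i j - treeInd G l j = χ l * (δ - treeInd G l j) := fun l => by
    by_cases hl : Relation.ReflTransGen (fun a b => (a, b) ∈ G) l i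
    · simp [χ, hl, treeInd_congr (inTreeRootedAt_congr_of_reach hGf.2.1 hl)]
    · simp [χ, hl, hδ]
  have hins : ∀ m, (if Relation.ReflTransGen (fun a b => (a, b) ∈ G) m i then 0
      else W i m * Ψ (insert (i, m) G)) =
      (if G.card = k then χ m * W i m * (treeInd G m j - δ) else 0) +
      if G.card + 1 = k then ∑ l, (χ m * W i m) * (χ l * W i l) *
        (treeInd G m j - treeInd G l j) else 0 := fun m => by
    by_cases hm : Relation.ReflTransGen (fun a b => (a, b) ∈ G) m i
    · simp [χ, hm]
    have hmi := treeInd_congr (inTreeRootedAt_insert (j := j) (m := m) hm)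
    rcases (hW i m).eq_or_lt with hw | hw
    · simp [hm, ← hw]
    have hF := hGf.insert hi hm hw
    have him : treeInd (insert (i, m) G) i j = treeInd G m j :=
      (treeInd_congr (inTreeRootedAt_congr_of_mem hF.2.1 (Finset.mem_insert_self _ _))).trans hmi
    have hrow : ∀ l, treeInd (insert (i, m) G) i j - treeInd (insert (i, m) G) l j =
        χ l * (treeInd G m j - treeInd G l j) := fun l => by
      by_cases hl : Relation.ReflTransGen (fun a b => (a, b) ∈ G) l i
      · simp [χ, hl, treeInd_congr (inTreeRootedAt_congr_of_reach (j := j) hF.2.1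
          (reach_mono (Finset.subset_insert _ _) hl))]
      · simp [χ, hl, him, treeInd_congr (inTreeRootedAt_insert (j := j) (m := m) hl)]
    have hχ : χ m = 1 := by simp [χ, hm]
    simp only [hm, if_false, Ψ, card_insert_of_root hi, hrow, hχ, add_left_inj, mul_add]
    congr 1
    · rw [him]
      split_ifs <;> ring
    · split_ifs
      · rw [Finset.mul_sum]
        exact Finset.sum_congr rfl fun l _ => by ring
      · ring
  have hanti : ∑ m, ∑ l, (χ m * W i m) * (χ l * W i l) * (treeInd G m j - treeInd G l j) = 0 := by
    simp only [mul_sub, Finset.sum_sub_distrib, sub_eq_zero]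
    rw [Finset.sum_comm]
    exact Finset.sum_congr rfl fun l _ => Finset.sum_congr rfl fun m _ => by ring
  simp only [hins, Finset.sum_add_distrib]
  have hcanc : Ψ G + ∑ m, (if G.card = k then χ m * W i m * (treeInd G m j - δ) else 0) = 0 := by
    simp only [Ψ, hG_row]
    simp only [hδ, sub_self, ite_self, zero_add]
    split_ifs
    · rw [← Finset.sum_add_distrib]
      exact Finset.sum_eq_zero fun m _ => by ring
    · simp
  rw [← add_assoc, hcanc]
  split_ifs
  · rw [hanti]; ring
  · simp

lemma forestMatrix_zero : forestMatrix W 0 = sigmaW W 0 • (1 : Matrix (Fin n) (Fin n) ℝ) := by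
  ext i j
  rw [Matrix.smul_apply, smul_eq_mul, forestMatrix_apply, sigmaW_eq, Finset.sum_mul]
  refine Finset.sum_congr rfl fun A _ => ?_
  split_ifs with h
  · obtain rfl := Finset.card_eq_zero.1 h
    rw [treeInd_of_root (by simp), mul_one]
  · simp

lemma commute_lap_forestMatrix (hW : ∀ i j, 0 ≤ W i j) (k : ℕ) :
    Commute (lap W) (forestMatrix W k) := by
  induction k with
  | zero =>
    rw [forestMatrix_zero]
    exact (Commute.one_right _).smul_right _
  | succ k ih =>
    rw [forestMatrix_succ hW]
    exact ((Commute.one_right _).smul_right _).sub_right ((Commute.refl _).mul_right ih)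

lemma trace_forestMatrix (k : ℕ) : (forestMatrix W k).trace = (n - k : ℝ) * sigmaW W k := by
  classical
  simp only [Matrix.trace, Matrix.diag_apply, forestMatrix_apply, sigmaW_eq]
  rw [Finset.sum_comm, Finset.mul_sum]
  refine Finset.sum_congr rfl fun A hA => ?_
  rw [← Finset.mul_sum]
  split_ifs with h
  · have hcard : (Finset.univ.filter fun i => InTreeRootedAt A i i) = (A.image Prod.fst)ᶜ := by
      ext i
      simp [inTreeRootedAt_self]
      grind
    have hF := mem_inForests.1 hA
    simp only [treeInd, Finset.sum_boole, hcard, Finset.card_compl, hF.card_image_fst,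
      Fintype.card_fin]
    rw [Nat.cast_sub hF.card_le, h]
    ring
  · simp

lemma IsInForest.card_le_maxForestCard (hA : IsInForest W A) : A.card ≤ maxForestCard W := by
  classical
  exact Finset.le_sup (f := Finset.card) (by simpa using hA)

lemma exists_card_eq_maxForestCard : ∃ A, IsInForest W A ∧ A.card = maxForestCard W := by
  classical
  obtain ⟨A, hA, h⟩ := Finset.exists_mem_eq_sup
    (Finset.univ.powerset.filter fun A => IsInForest W A)
    ⟨∅, by simpa using isInForest_empty⟩ Finset.card
  refine ⟨A, by simpa using hA, ?_⟩
  rw [← h, maxForestCard]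

lemma maxForestCard_le : maxForestCard W ≤ n := by
  obtain ⟨A, hA, h⟩ := exists_card_eq_maxForestCard (W := W)
  exact h ▸ hA.card_le

lemma sigmaW_maxForestCard_pos : 0 < sigmaW W (maxForestCard W) := by
  classical
  obtain ⟨A, hA, h⟩ := exists_card_eq_maxForestCard (W := W)
  exact Finset.sum_pos (fun B hB => (Finset.mem_filter.1 hB).2.1.forestWeight_pos)
    ⟨A, by simp [hA, h]⟩

lemma inForests_card_ne (hA : A ∈ inForests W) : A.card ≠ maxForestCard W + 1 :=
  (Nat.lt_succ_of_le (mem_inForests.1 hA).card_le_maxForestCard).ne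

lemma lap_mul_forestMatrix_max (hW : ∀ i j, 0 ≤ W i j) :
    lap W * forestMatrix W (maxForestCard W) = 0 := by
  have hσ : sigmaW W (maxForestCard W + 1) = 0 := by
    rw [sigmaW_eq]
    exact Finset.sum_eq_zero fun A hA => by simp [inForests_card_ne hA]
  have hQ : forestMatrix W (maxForestCard W + 1) = 0 := by
    ext i j
    rw [forestMatrix_apply]
    exact Finset.sum_eq_zero fun A hA => by simp [inForests_card_ne hA]
  simpa [hσ, hQ] using (forestMatrix_succ hW (maxForestCard W)).symm

lemma lap_mul_Jtilde (hW : ∀ i j, 0 ≤ W i j) : lap W * Jtilde W = 0 := by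
  rw [Jtilde, Matrix.mul_smul, lap_mul_forestMatrix_max hW, smul_zero]

lemma Jtilde_mul_lap (hW : ∀ i j, 0 ≤ W i j) : Jtilde W * lap W = 0 := by
  rw [Jtilde, Matrix.smul_mul, ← (commute_lap_forestMatrix hW _).eq,
    lap_mul_forestMatrix_max hW, smul_zero]

lemma trace_Jtilde : (Jtilde W).trace = forestDim W := by
  rw [Jtilde, Matrix.trace_smul, trace_forestMatrix, forestDim, Nat.cast_sub maxForestCard_le,
    smul_eq_mul]
  have := (sigmaW_maxForestCard_pos (W := W)).ne'
  field_simp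

/-- `J̃` differs from the identity by a right multiple of `L`. -/
lemma exists_Jtilde_add_mul_lap (hW : ∀ i j, 0 ≤ W i j) :
    ∃ N, Jtilde W + N * lap W = 1 := by
  have hσ := (sigmaW_maxForestCard_pos (W := W)).ne'
  rw [Jtilde]
  generalize maxForestCard W = k at hσ
  cases k with
  | zero => exact ⟨0, by rw [forestMatrix_zero, inv_smul_smul₀ hσ, Matrix.zero_mul, add_zero]⟩
  | succ k =>
    refine ⟨(sigmaW W (k + 1))⁻¹ • forestMatrix W k, ?_⟩
    rw [forestMatrix_succ hW, smul_sub, inv_smul_smul₀ hσ, Matrix.smul_mul,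
      (commute_lap_forestMatrix hW k).eq, sub_add_cancel]

end Forests

section LinearAlgebra

variable {n : ℕ}

/-- The characteristic polynomial of a multiple of an idempotent complex matrix of trace `d`. -/
lemma charpoly_smul_of_idempotent {P : Matrix (Fin n) (Fin n) ℂ} (hP : P * P = P) {d : ℕ}
    (htr : P.trace = d) (hd : d ≤ n) (α : ℂ) :
    (α • P).charpoly = X ^ (n - d) * (X - C α) ^ d := by
  rcases eq_or_ne α 0 with rfl | hα
  · simp [Matrix.charpoly_zero, ← pow_add, Nat.sub_add_cancel hd]
  have hroot : ∀ z ∈ (α • P).charpoly.roots, z = 0 ∨ z = α := by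
    intro z hz
    have hz' := Polynomial.isRoot_of_mem_roots hz
    rw [← Matrix.mem_spectrum_iff_isRoot_charpoly] at hz'
    have hann : aeval (α • P) (X * (X - C α)) = 0 := by
      simp [mul_sub, hP, Algebra.algebraMap_eq_smul_one, smul_smul]
    have := spectrum.subset_polynomial_aeval (α • P) (X * (X - C α)) ⟨z, hz', rfl⟩
    rcases isEmpty_or_nonempty (Fin n) with h | h
    · simp [spectrum.of_subsingleton] at hz'
    rw [hann, spectrum.zero_eq, Set.mem_singleton_iff] at this
    simpa [sub_eq_zero] using this
  have hcard : Multiset.card (α • P).charpoly.roots = n := by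
    rw [← (IsAlgClosed.splits _).natDegree_eq_card_roots, Matrix.charpoly_natDegree_eq_dim,
      Fintype.card_fin]
  have hsum := Matrix.trace_eq_sum_roots_charpoly (α • P)
  rw [Matrix.trace_smul, htr, smul_eq_mul] at hsum
  have hsplit : ∀ s : Multiset ℂ, (∀ z ∈ s, z = 0 ∨ z = α) →
      ∃ b ≤ Multiset.card s, s.sum = α * b ∧
        (s.map fun z => X - C z).prod = X ^ (Multiset.card s - b) * (X - C α) ^ b := by
    intro s
    induction s using Multiset.induction_on with
    | empty => exact fun _ => ⟨0, by simp⟩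
    | cons a s ih =>
      intro hs
      obtain ⟨b, hb, hsb, hp⟩ := ih fun z hz => hs z (Multiset.mem_cons_of_mem hz)
      rcases hs a (Multiset.mem_cons_self _ _) with rfl | rfl
      · refine ⟨b, by simp; omega, by simpa using hsb, ?_⟩
        rw [Multiset.map_cons, Multiset.prod_cons, hp, Multiset.card_cons, Nat.sub_add_comm hb]
        simp only [map_zero, sub_zero]
        ring
      · refine ⟨b + 1, by simp; omega, by simp [hsb]; ring, ?_⟩
        rw [Multiset.map_cons, Multiset.prod_cons, hp, Multiset.card_cons, Nat.add_sub_add_right]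
        ring
  obtain ⟨b, -, hsb, hp⟩ := hsplit _ hroot
  rw [← hsum] at hsb
  obtain rfl : d = b := by exact_mod_cast mul_left_cancel₀ hα hsb
  rw [hcard] at hp
  rw [← hp]
  exact (IsAlgClosed.splits _).eq_prod_roots_of_monic (Matrix.charpoly_monic _)

lemma charpoly_mul_charpoly_of_mul_eq_zero {R : Type*} [CommRing R] {M N : Matrix (Fin n) (Fin n) R}
    (h : M * N = 0) : M.charpoly * N.charpoly = X ^ n * (M + N).charpoly := by
  have hmap : M.map C * N.map C = 0 := by
    rw [← Matrix.map_mul, h, Matrix.map_zero _ C.map_zero]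
  have hmat : M.charmatrix * N.charmatrix = (X : R[X]) • (M + N).charmatrix := by
    simp only [Matrix.charmatrix, RingHom.mapMatrix_apply, Matrix.scalar_apply,
      ← Matrix.smul_one_eq_diagonal, Matrix.map_add C (fun _ _ => C_add)]
    rw [sub_mul, mul_sub, mul_sub, hmap]
    simp [smul_sub, smul_smul]
    abel
  rw [Matrix.charpoly, Matrix.charpoly, Matrix.charpoly, ← Matrix.det_mul, hmat, Matrix.det_smul,
    Fintype.card_fin]

/-- If `P` is the spectral projection of `M` at the semisimple eigenvalue `0`, adding `α • P`
moves that eigenvalue to `α`. -/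
theorem exists_charpoly_add_smul {M P N : Matrix (Fin n) (Fin n) ℂ} (hMP : M * P = 0)
    (hPM : P * M = 0) (hN : P + N * M = 1) {d : ℕ} (htr : P.trace = d) (hd : d ≤ n) :
    ∃ r : ℂ[X], r.eval 0 ≠ 0 ∧ M.charpoly = X ^ d * r ∧ ∀ α : ℂ,
      (M + α • P).charpoly = (X - C α) ^ d * r ∧ (α ≠ 0 → (M + α • P).det ≠ 0) := by
  have hP : P * P = P := by
    have := congrArg (· * P) hN
    simpa [add_mul, mul_assoc, hMP] using this
  have hX : (X : ℂ[X]) ^ (n - d) ≠ 0 := pow_ne_zero _ X_ne_zero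
  have key : ∀ α : ℂ, M.charpoly * (X - C α) ^ d = X ^ d * (M + α • P).charpoly := fun α => by
    have h := charpoly_mul_charpoly_of_mul_eq_zero (M := M) (N := α • P) (by simp [hMP])
    have hn : (X : ℂ[X]) ^ n = X ^ (n - d) * X ^ d := by rw [← pow_add, Nat.sub_add_cancel hd]
    rw [charpoly_smul_of_idempotent hP htr hd, hn] at h
    exact mul_left_cancel₀ hX (by linear_combination h)
  have hdet : ∀ α : ℂ, α ≠ 0 → (M + α • P).det ≠ 0 := fun α hα => by
    refine Matrix.det_ne_zero_of_left_inverse (B := α⁻¹ • P + (N - N * P)) ?_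
    simp [add_mul, mul_add, sub_mul, mul_assoc, hPM, hP, smul_smul, hα, hN, add_comm]
  have hdvd : (X : ℂ[X]) ^ d ∣ M.charpoly := by
    have hcop : IsCoprime ((X : ℂ[X]) ^ d) ((X - C 1) ^ d) :=
      IsCoprime.pow ⟨1, -1, by simp⟩
    exact hcop.dvd_of_dvd_mul_right ⟨_, key 1⟩
  obtain ⟨r, hr⟩ := hdvd
  have hchar : ∀ α : ℂ, (M + α • P).charpoly = (X - C α) ^ d * r := fun α => by
    have h := key α
    rw [hr] at h
    exact mul_left_cancel₀ (pow_ne_zero d X_ne_zero) (by linear_combination -h)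
  refine ⟨r, fun h0 => ?_, hr, fun α => ⟨hchar α, hdet α⟩⟩
  apply hdet 1 one_ne_zero
  rw [Matrix.det_eq_sign_charpoly_coeff, Polynomial.coeff_zero_eq_eval_zero, hchar 1]
  simp [h0]

end LinearAlgebra

/-- For every `α ∈ ℂ`, the spectrum of `L + αJ̃` consists of the nonzero
eigenvalues of `L` (with multiplicities) together with `α` with multiplicity `d`;
in particular `L + αJ̃` is nonsingular for `α ≠ 0`. -/
theorem spectrum_lap_add_smul_Jtilde {n : ℕ} (W : Matrix (Fin n) (Fin n) ℝ)
    (hn : 1 < n) (hW : ∀ i j, 0 ≤ W i j) (hdiag : ∀ i, W i i = 0) :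
    ∃ r : Polynomial ℂ, r.eval 0 ≠ 0 ∧
      ((lap W).map Complex.ofReal).charpoly = Polynomial.X ^ (forestDim W) * r ∧
      ∀ α : ℂ,
        ((lap W).map Complex.ofReal + α • (Jtilde W).map Complex.ofReal).charpoly =
          (Polynomial.X - Polynomial.C α) ^ (forestDim W) * r ∧
        (α ≠ 0 →
          ((lap W).map Complex.ofReal + α • (Jtilde W).map Complex.ofReal).det ≠ 0) := by
  have hcast : ∀ A B : Matrix (Fin n) (Fin n) ℝ,
      (A * B).map Complex.ofReal = A.map Complex.ofReal * B.map Complex.ofReal := fun A B =>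
    Matrix.map_mul (f := Complex.ofRealHom)
  obtain ⟨N, hN⟩ := exists_Jtilde_add_mul_lap hW
  refine exists_charpoly_add_smul (N := N.map Complex.ofReal) ?_ ?_ ?_ ?_ (Nat.sub_le _ _)
  · rw [← hcast, lap_mul_Jtilde hW, Matrix.map_zero _ Complex.ofReal_zero]
  · rw [← hcast, Jtilde_mul_lap hW, Matrix.map_zero _ Complex.ofReal_zero]
  · rw [← hcast, ← Matrix.map_add _ Complex.ofReal_add, hN,
      Matrix.map_one _ Complex.ofReal_zero Complex.ofReal_one]
  · have := congrArg Complex.ofReal (trace_Jtilde (W := W))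
    simpa [Matrix.trace] using this
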